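/- arXiv:2309.12472 — 2 statements merged into one kernel-verified Lean document; each statement's English description precedes it below -/
import Mathlib

section
/- For a positive element a of a C*-algebra A and ε > 0, the closed ideal generated by (a−ε)_+ is compactly contained in the closed ideal generated by a. -/
/-- `I ⋐ J`: whenever `J` is contained in the closed sum of a family of closed two-sided
ideals, `I` is contained in a finite subsum. -/
def CompactlyContained {A : Type*} [NonUnitalCStarAlgebra A]
    (I J : TwoSidedIdeal A) : Prop :=
  ∀ {Λ : Type} (f : Λ → TwoSidedIdeal A), (∀ l, IsClosed (f l : Set A)) →
    (J : Set A) ⊆ closure ((⨆ l, f l : TwoSidedIdeal A) : Set A) →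
    ∃ s : Finset Λ, (I : Set A) ⊆ ((s.sup f : TwoSidedIdeal A) : Set A)

/-- The closed two-sided ideal of `A` generated by a set: the smallest closed two-sided ideal
containing it. -/
def genClosedIdeal {A : Type*} [NonUnitalCStarAlgebra A] (s : Set A) : TwoSidedIdeal A :=
  sInf {J : TwoSidedIdeal A | IsClosed (J : Set A) ∧ s ⊆ J}

theorem AddSubgroup.isClosed_sup_of_norm_le {E : Type*} [NormedAddCommGroup E] [CompleteSpace E]
    {S T : AddSubgroup E} (hS : IsClosed (S : Set E)) (hT : IsClosed (T : Set E)) {C : ℝ}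
    (hC : 0 < C)
    (h : ∀ s ∈ S, ∀ t ∈ T, ∃ s' ∈ S, ∃ t' ∈ T, s' + t' = s + t ∧
      ‖s'‖ ≤ C * ‖s + t‖ ∧ ‖t'‖ ≤ C * ‖s + t‖) :
    IsClosed ((S ⊔ T : AddSubgroup E) : Set E) := by
  have : CompleteSpace S := hS.completeSpace_coe
  have : CompleteSpace T := hT.completeSpace_coe
  let F : NormedAddGroupHom (S × T) E :=
    (S.subtype.coprod T.subtype).mkNormedAddGroupHom 2 fun v => by
      calc ‖(v.1 : E) + v.2‖ ≤ ‖v.1‖ + ‖v.2‖ := norm_add_le _ _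
        _ ≤ 2 * ‖v‖ := by linarith [norm_fst_le v, norm_snd_le v]
  have hF (v : S × T) : F v = (v.1 : E) + v.2 := rfl
  have hsurj : F.SurjectiveOnWith (S ⊔ T) C := by
    intro x hx
    obtain ⟨s, hs, t, ht, rfl⟩ := AddSubgroup.mem_sup.1 hx
    obtain ⟨s', hs', t', ht', hst, h₁, h₂⟩ := h s hs t ht
    exact ⟨(⟨s', hs'⟩, ⟨t', ht'⟩), hst, max_le h₁ h₂⟩
  have hcl := controlled_closure_of_complete hC one_pos hsurj
  refine isClosed_of_closure_subset fun x hx => ?_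
  obtain ⟨v, rfl, -⟩ := hcl x hx
  rw [hF]
  exact add_mem (AddSubgroup.mem_sup_left v.1.2) (AddSubgroup.mem_sup_right v.2.2)

section CutdownInverse

/-- A continuous function vanishing at `0` which agrees with `t⁻¹` for `t ≥ η`. -/
noncomputable def cutdownInv (η t : ℝ) : ℝ := t / max t η ^ 2

variable {η : ℝ}

theorem continuous_cutdownInv (hη : 0 < η) : Continuous (cutdownInv η) := by
  unfold cutdownInv
  refine continuous_id.div (by fun_prop) fun t => ?_
  have := lt_max_of_lt_right (b := t) hη
  positivity

@[simp]
theorem cutdownInv_zero (η : ℝ) : cutdownInv η 0 = 0 := by simp [cutdownInv]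

theorem cutdownInv_of_le (hη : 0 < η) {t : ℝ} (ht : η ≤ t) : cutdownInv η t = t⁻¹ := by
  have : 0 < t := hη.trans_le ht
  rw [cutdownInv, max_eq_left ht]
  field_simp

theorem cutdownInv_nonneg {t : ℝ} (ht : 0 ≤ t) : 0 ≤ cutdownInv η t := by
  unfold cutdownInv; positivity

theorem cutdownInv_le_inv (hη : 0 < η) (t : ℝ) : cutdownInv η t ≤ η⁻¹ := by
  have hm := lt_max_of_lt_right (b := t) hη
  rw [cutdownInv, div_le_iff₀ (by positivity), ← div_eq_inv_mul, le_div_iff₀ hη, pow_two]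
  gcongr
  · exact le_max_left _ _
  · exact le_max_right _ _

theorem mul_cutdownInv_le_one (hη : 0 < η) {t : ℝ} (ht : 0 ≤ t) : t * cutdownInv η t ≤ 1 := by
  have hm := lt_max_of_lt_right (b := t) hη
  rw [cutdownInv, ← mul_div_assoc, div_le_one (by positivity), pow_two]
  gcongr <;> exact le_max_left _ _

end CutdownInverse

section CStar

variable {A : Type*} [NonUnitalCStarAlgebra A] [PartialOrder A] [StarOrderedRing A]

theorem norm_cfcₙ_cutdownInv_le {a : A} (ha : 0 ≤ a) {η : ℝ} (hη : 0 < η) :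
    ‖cfcₙ (cutdownInv η) a‖ ≤ η⁻¹ := by
  refine norm_cfcₙ_le fun t ht => ?_
  rw [Real.norm_of_nonneg (cutdownInv_nonneg (quasispectrum_nonneg_of_nonneg a ha t ht))]
  exact cutdownInv_le_inv hη t

theorem cfcₙ_max_sub_mul_cutdownInv_mul {a : A} (ha : 0 ≤ a) {ε : ℝ} (hε : 0 < ε) :
    cfcₙ (fun t : ℝ => max 0 (t - ε)) a * (cfcₙ (cutdownInv ε) a * a) =
      cfcₙ (fun t : ℝ => max 0 (t - ε)) a := by
  have hq := (continuous_cutdownInv hε).continuousOn (s := quasispectrum ℝ a)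
  conv_lhs => enter [2, 2]; rw [← cfcₙ_id' ℝ a]
  rw [← cfcₙ_mul _ _ a, ← cfcₙ_mul _ _ a (by fun_prop) (by simp [hε.le]) (by fun_prop) (by simp)]
  refine cfcₙ_congr fun t _ => ?_
  rcases le_total t ε with h | h
  · simp [h]
  · have : t ≠ 0 := (hε.trans_le h).ne'
    simp [cutdownInv_of_le hε h, this]

theorem TwoSidedIdeal.exists_mem_norm_sub_mul_le (I : TwoSidedIdeal A) {x : A} (hx : x ∈ I)
    {δ : ℝ} (hδ : 0 < δ) : ∃ e ∈ I, ‖e‖ ≤ 1 ∧ ‖x - e * x‖ ≤ δ := by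
  set η := δ ^ 2 / 2 with hη_def
  have hη : 0 < η := by positivity
  set b := x * star x with hb_def
  have hb : 0 ≤ b := mul_star_self_nonneg x
  have hq := (continuous_cutdownInv hη).continuousOn (s := quasispectrum ℝ b)
  have he : cfcₙ (fun t => t * cutdownInv η t) b = b * cfcₙ (cutdownInv η) b := by
    rw [cfcₙ_mul _ _ b, cfcₙ_id' ℝ b]
  have hprod : cfcₙ (fun t => t * cutdownInv η t * t) b =
      cfcₙ (fun t => t * cutdownInv η t) b * b := by
    rw [cfcₙ_mul (fun t => t * cutdownInv η t) _ b, cfcₙ_id' ℝ b]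
  have hdiff : b - cfcₙ (fun t => t * cutdownInv η t) b * b =
      cfcₙ (fun t => t - t * cutdownInv η t * t) b := by
    rw [cfcₙ_sub _ _ b, cfcₙ_id' ℝ b, hprod]
  have hstar : star (cfcₙ (fun t => t * cutdownInv η t) b) =
      cfcₙ (fun t => t * cutdownInv η t) b := (cfcₙ_predicate _ b : IsSelfAdjoint _)
  set e := cfcₙ (fun t => t * cutdownInv η t) b
  have hnorm : ‖e‖ ≤ 1 := norm_cfcₙ_le fun t ht => by
    have ht0 := quasispectrum_nonneg_of_nonneg b hb t ht
    rw [Real.norm_of_nonneg (mul_nonneg ht0 (cutdownInv_nonneg ht0))]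
    exact mul_cutdownInv_le_one hη ht0
  have hsmall : ‖b - e * b‖ ≤ η := hdiff ▸ norm_cfcₙ_le fun t ht => by
    have ht0 := quasispectrum_nonneg_of_nonneg b hb t ht
    have h1 := mul_cutdownInv_le_one hη ht0
    have h0 := mul_nonneg ht0 (cutdownInv_nonneg (η := η) ht0)
    rw [Real.norm_of_nonneg (by nlinarith)]
    rcases le_total t η with h | h
    · nlinarith
    · have : t ≠ 0 := (hη.trans_le h).ne'
      simp [cutdownInv_of_le hη h, this, hη.le]
  refine ⟨e, he ▸ I.mul_mem_right _ _ (I.mul_mem_right _ _ hx), hnorm, ?_⟩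
  have hsq : (x - e * x) * star (x - e * x) = (b - e * b) - (b - e * b) * e := by
    rw [star_sub, star_mul, hstar, hb_def]
    noncomm_ring
  have : ‖x - e * x‖ * ‖x - e * x‖ ≤ δ ^ 2 := by
    rw [← CStarRing.norm_self_mul_star, hsq]
    calc _ ≤ ‖b - e * b‖ + ‖b - e * b‖ * ‖e‖ :=
        (norm_sub_le _ _).trans (by gcongr; exact norm_mul_le _ _)
      _ ≤ η + η * 1 := by gcongr
      _ = δ ^ 2 := by rw [hη_def]; ring
  exact abs_le_of_sq_le_sq' (by rwa [pow_two]) hδ.le |>.2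

theorem TwoSidedIdeal.isClosed_sup {I J : TwoSidedIdeal A} (hI : IsClosed (I : Set A))
    (hJ : IsClosed (J : Set A)) : IsClosed ((I ⊔ J : TwoSidedIdeal A) : Set A) := by
  have hsup : ((I ⊔ J : TwoSidedIdeal A) : Set A) =
      ((AddSubgroup.ofClass I ⊔ AddSubgroup.ofClass J : AddSubgroup A) : Set A) := by
    ext x
    rw [SetLike.mem_coe, SetLike.mem_coe, TwoSidedIdeal.mem_sup, AddSubgroup.mem_sup]
    rfl
  rw [hsup]
  refine AddSubgroup.isClosed_sup_of_norm_le (C := 3) hI hJ (by norm_num) fun i hi j hj => ?_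
  rcases eq_or_ne (i + j) 0 with h0 | h0
  · exact ⟨0, zero_mem _, 0, zero_mem _, by simp [h0]⟩
  obtain ⟨e, he, he1, hie⟩ := I.exists_mem_norm_sub_mul_le hi (norm_pos_iff.2 h0)
  have hs : ‖e * (i + j) + (i - e * i)‖ ≤ 2 * ‖i + j‖ := by
    calc _ ≤ ‖e‖ * ‖i + j‖ + ‖i - e * i‖ :=
        (norm_add_le _ _).trans (by gcongr; exact norm_mul_le _ _)
      _ ≤ 1 * ‖i + j‖ + ‖i + j‖ := by gcongr
      _ = 2 * ‖i + j‖ := by ring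
  refine ⟨e * (i + j) + (i - e * i), ?_, j - e * j, ?_, by noncomm_ring, ?_, ?_⟩
  · exact I.add_mem (I.mul_mem_right _ _ he) (I.sub_mem hi (I.mul_mem_left _ _ hi))
  · exact J.sub_mem hj (J.mul_mem_left _ _ hj)
  · linarith [norm_nonneg (i + j)]
  · calc ‖j - e * j‖ = ‖(i + j) - (e * (i + j) + (i - e * i))‖ := by congr 1; noncomm_ring
      _ ≤ ‖i + j‖ + ‖e * (i + j) + (i - e * i)‖ := norm_sub_le _ _
      _ ≤ 3 * ‖i + j‖ := by linarith

theorem TwoSidedIdeal.isClosed_finset_sup {Λ : Type*} {f : Λ → TwoSidedIdeal A}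
    (hf : ∀ l, IsClosed (f l : Set A)) (s : Finset Λ) :
    IsClosed ((s.sup f : TwoSidedIdeal A) : Set A) :=
  Finset.sup_induction (p := fun I : TwoSidedIdeal A => IsClosed (I : Set A))
    (by simp) (fun _ hI _ hJ => isClosed_sup hI hJ) fun l _ => hf l

theorem cfcₙ_max_sub_mem_of_norm_sub_lt {K : TwoSidedIdeal A} (hK : IsClosed (K : Set A))
    {a b : A} (ha : 0 ≤ a) (hb : b ∈ K) {ε : ℝ} (hε : 0 < ε) (hab : ‖a - b‖ < ε) :
    cfcₙ (fun t : ℝ => max 0 (t - ε)) a ∈ K := by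
  have hx := cfcₙ_max_sub_mul_cutdownInv_mul ha hε
  have hw := norm_cfcₙ_cutdownInv_le ha hε
  set x := cfcₙ (fun t : ℝ => max 0 (t - ε)) a
  set w := cfcₙ (cutdownInv ε) a
  set ρ := ε⁻¹ * ‖a - b‖
  have hρ : ρ < 1 := (inv_mul_lt_one₀ hε).2 hab
  have hρ0 : 0 ≤ ρ := by positivity
  have key (n : ℕ) : ∃ k ∈ K, ‖x - k‖ ≤ ρ ^ n * ‖x‖ := by
    induction n with
    | zero => exact ⟨0, K.zero_mem, by simp⟩
    | succ n ih =>
      obtain ⟨k, hk, hxk⟩ := ih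
      refine ⟨k * (w * (a - b)) + x * (w * b), K.add_mem (K.mul_mem_right _ _ hk)
        (K.mul_mem_left _ _ (K.mul_mem_left _ _ hb)), ?_⟩
      have : x - (k * (w * (a - b)) + x * (w * b)) = (x - k) * (w * (a - b)) := by
        nth_rw 1 [← hx]
        noncomm_ring
      calc _ = ‖(x - k) * (w * (a - b))‖ := by rw [this]
        _ ≤ ‖x - k‖ * (‖w‖ * ‖a - b‖) :=
          (norm_mul_le _ _).trans (by gcongr; exact norm_mul_le _ _)
        _ ≤ (ρ ^ n * ‖x‖) * (ε⁻¹ * ‖a - b‖) := by gcongr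
        _ = (ρ ^ n * ‖x‖) * ρ := rfl
        _ = ρ ^ (n + 1) * ‖x‖ := by ring
  choose k hkK hk using key
  refine hK.mem_of_tendsto (f := k) (b := Filter.atTop) ?_ (.of_forall hkK)
  rw [tendsto_iff_norm_sub_tendsto_zero]
  refine squeeze_zero (fun _ => norm_nonneg _) (fun n => norm_sub_rev x (k n) ▸ hk n) ?_
  simpa using (tendsto_pow_atTop_nhds_zero_of_lt_one hρ0 hρ).mul_const ‖x‖

end CStar

theorem TwoSidedIdeal.exists_mem_finset_sup_of_mem_iSup {R : Type*} [NonUnitalNonAssocRing R]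
    {Λ : Type*} {f : Λ → TwoSidedIdeal R} {x : R} (hx : x ∈ ⨆ l, f l) :
    ∃ s : Finset Λ, x ∈ s.sup f := by
  classical
  let U : TwoSidedIdeal R := .mk' {x | ∃ s : Finset Λ, x ∈ s.sup f}
    ⟨∅, TwoSidedIdeal.zero_mem _⟩
    (by
      rintro x y ⟨s, hs⟩ ⟨t, ht⟩
      exact ⟨s ∪ t, TwoSidedIdeal.add_mem _
        (TwoSidedIdeal.le_iff.1 (Finset.sup_mono Finset.subset_union_left) hs)
        (TwoSidedIdeal.le_iff.1 (Finset.sup_mono Finset.subset_union_right) ht)⟩)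
    (by rintro x ⟨s, hs⟩; exact ⟨s, TwoSidedIdeal.neg_mem _ hs⟩)
    (by rintro x y ⟨s, hs⟩; exact ⟨s, TwoSidedIdeal.mul_mem_left _ _ _ hs⟩)
    (by rintro x y ⟨s, hs⟩; exact ⟨s, TwoSidedIdeal.mul_mem_right _ _ _ hs⟩)
  have hmem {y : R} : y ∈ U ↔ ∃ s : Finset Λ, y ∈ s.sup f :=
    TwoSidedIdeal.mem_mk' _ _ _ _ _ _ y
  have hU : ⨆ l, f l ≤ U := iSup_le fun l y hy =>
    hmem.2 ⟨{l}, by simpa using hy⟩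
  exact hmem.1 (hU hx)

/-- For a positive element `a` of a C*-algebra and `ε > 0`, the closed ideal generated by
`(a - ε)₊` is compactly contained in the closed ideal generated by `a`. -/
theorem genClosedIdeal_cutdown_compactlyContained {A : Type*} [NonUnitalCStarAlgebra A]
    [PartialOrder A] [StarOrderedRing A] (a : A) (ha : 0 ≤ a) (ε : ℝ) (hε : 0 < ε) :
    CompactlyContained (genClosedIdeal {cfcₙ (fun t : ℝ => max 0 (t - ε)) a})
      (genClosedIdeal {a}) := by
  intro Λ f hf hJ
  have ha_mem : a ∈ genClosedIdeal {a} :=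
    (TwoSidedIdeal.mem_sInf A).2 fun J hJ => hJ.2 (Set.mem_singleton a)
  obtain ⟨b, hb, hab⟩ := Metric.mem_closure_iff.1 (hJ ha_mem) ε hε
  obtain ⟨s, hs⟩ := TwoSidedIdeal.exists_mem_finset_sup_of_mem_iSup hb
  have hcl := TwoSidedIdeal.isClosed_finset_sup hf s
  refine ⟨s, fun y hy => (TwoSidedIdeal.mem_sInf A).1 hy _
    ⟨hcl, Set.singleton_subset_iff.2 ?_⟩⟩
  exact cfcₙ_max_sub_mem_of_norm_sub_lt hcl ha hs hε (by rwa [← dist_eq_norm])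
end

section
/- Let X be a locally compact Hausdorff space and A, B C*-algebras. A completely positive map φ : A → C₀(X, B) is nuclear if and only if the composition ev_x ∘ φ : A → B with evaluation at x is nuclear for every x ∈ X. -/
open ZeroAtInfty

noncomputable instance {X B : Type*} [TopologicalSpace X] [NonUnitalCStarAlgebra B] :
    NonUnitalCStarAlgebra C₀(X, B) where

/-- The C*-algebra of `n × n` complex matrices, realized as operators on `ℂⁿ`. -/
abbrev MatAlg (n : ℕ) : Type :=
  EuclideanSpace ℂ (Fin n) →L[ℂ] EuclideanSpace ℂ (Fin n)

/-- A linear map between C*-algebras is completely positive if all its matrix amplifications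
preserve positivity (where a matrix is positive iff it is of the form `N* N`). -/
def IsCP {R S : Type*} [NonUnitalCStarAlgebra R] [NonUnitalCStarAlgebra S]
    (φ : R →ₗ[ℂ] S) : Prop :=
  ∀ (n : ℕ) (M : Matrix (Fin n) (Fin n) R),
    (∃ N : Matrix (Fin n) (Fin n) R, M = N.conjTranspose * N) →
    ∃ N' : Matrix (Fin n) (Fin n) S, M.map φ = N'.conjTranspose * N'

/-- A c.p. map is nuclear if it is a point-norm limit of compositions of c.p.c. maps through
matrix algebras. -/
def IsNuclearMap {R S : Type*} [NonUnitalCStarAlgebra R] [NonUnitalCStarAlgebra S]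
    (φ : R →ₗ[ℂ] S) : Prop :=
  ∀ ε : ℝ, 0 < ε → ∀ F : Finset R,
    ∃ (n : ℕ) (κ : R →ₗ[ℂ] MatAlg n) (ρ : MatAlg n →ₗ[ℂ] S),
      IsCP κ ∧ IsCP ρ ∧ (∀ a, ‖κ a‖ ≤ ‖a‖) ∧ (∀ m, ‖ρ m‖ ≤ ‖m‖) ∧
        ∀ a ∈ F, ‖φ a - ρ (κ a)‖ ≤ ε

/-- Evaluation at a point, as a linear map `C₀(X, B) →ₗ[ℂ] B`. -/
def evalLM {X B : Type*} [TopologicalSpace X] [NonUnitalCStarAlgebra B] (x : X) :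
    C₀(X, B) →ₗ[ℂ] B where
  toFun f := f x
  map_add' _ _ := rfl
  map_smul' _ _ := rfl

open ContinuousLinearMap InnerProductSpace

section Gram

variable {S : Type*} [NonUnitalCStarAlgebra S]

lemma exists_star_mul_self_eq_sum {ι : Type*} (s : Finset ι) (x : ι → S) :
    ∃ y, ∑ i ∈ s, star (x i) * x i = star y * y := by
  let _ := CStarAlgebra.spectralOrder S
  have _ := CStarAlgebra.spectralOrderedRing S
  exact CStarAlgebra.nonneg_iff_eq_star_mul_self.mp
    (Finset.sum_nonneg fun i _ => star_mul_self_nonneg (x i))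

lemma Matrix.exists_conjTranspose_mul_self_sum {ι : Type*} (s : Finset ι) {n : ℕ}
    (M : ι → Matrix (Fin n) (Fin n) S)
    (hM : ∀ i ∈ s, ∃ N : Matrix (Fin n) (Fin n) S, M i = N.conjTranspose * N) :
    ∃ N : Matrix (Fin n) (Fin n) S, ∑ i ∈ s, M i = N.conjTranspose * N := by
  let _ := CStarAlgebra.spectralOrder S
  have _ := CStarAlgebra.spectralOrderedRing S
  choose! N hN using hM
  obtain ⟨y, hy⟩ := exists_star_mul_self_eq_sum (S := CStarMatrix (Fin n) (Fin n) S) s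
    fun i => CStarMatrix.ofMatrix (N i)
  refine ⟨CStarMatrix.ofMatrix.symm y, ?_⟩
  rw [Finset.sum_congr rfl hN]
  exact hy

lemma Matrix.exists_conjTranspose_mul_self_of_apply_eq_sum {ι : Type*} (s : Finset ι) {n : ℕ}
    (M : Matrix (Fin n) (Fin n) S) (R : ι → Fin n → S)
    (hM : ∀ i j, M i j = ∑ a ∈ s, star (R a i) * R a j) :
    ∃ N : Matrix (Fin n) (Fin n) S, M = N.conjTranspose * N := by
  obtain rfl | hn := Nat.eq_zero_or_pos n
  · exact ⟨0, Subsingleton.elim _ _⟩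
  obtain ⟨N, hN⟩ := Matrix.exists_conjTranspose_mul_self_sum s
    (fun a => Matrix.of fun i j => star (R a i) * R a j) fun a _ => by
      refine ⟨Matrix.of fun k j => if k = ⟨0, hn⟩ then R a j else 0, ?_⟩
      ext i j
      rw [Matrix.mul_apply, Finset.sum_eq_single ⟨0, hn⟩] <;> simp +contextual
  refine ⟨N, hN ▸ ?_⟩
  ext i j
  simp [hM, Matrix.sum_apply]

end Gram

section IsCP

variable {R S T : Type*} [NonUnitalCStarAlgebra R] [NonUnitalCStarAlgebra S]
  [NonUnitalCStarAlgebra T]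

lemma IsCP.comp {ψ : S →ₗ[ℂ] T} {φ : R →ₗ[ℂ] S} (hψ : IsCP ψ) (hφ : IsCP φ) :
    IsCP (ψ.comp φ) := fun n M hM => by
  simpa [Matrix.map_map] using hψ n _ (hφ n M hM)

lemma IsCP.sum {ι : Type*} (s : Finset ι) {φ : ι → R →ₗ[ℂ] S} (hφ : ∀ i ∈ s, IsCP (φ i)) :
    IsCP (∑ i ∈ s, φ i) := fun n M hM => by
  obtain ⟨N, hN⟩ := Matrix.exists_conjTranspose_mul_self_sum s (fun i => M.map (φ i))
    fun i hi => hφ i hi n M hM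
  refine ⟨N, hN ▸ ?_⟩
  ext i j
  simp [Matrix.sum_apply]

lemma isCP_evalLM {X : Type*} [TopologicalSpace X] (x : X) :
    IsCP (evalLM (B := S) x) := by
  rintro n M ⟨N, rfl⟩
  refine ⟨N.map (evalLM x), ?_⟩
  ext i j
  simp only [Matrix.map_apply, Matrix.mul_apply, map_sum, Matrix.conjTranspose_apply]
  rfl

end IsCP

section Compression

variable {n m : ℕ}

lemma exists_sum_adjoint_comp_eq_one (n : ℕ) {m : ℕ} (hm : 0 < m) :
    ∃ P : Fin n → (EuclideanSpace ℂ (Fin n) →L[ℂ] EuclideanSpace ℂ (Fin m)),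
      ∑ l, adjoint (P l) ∘L P l = 1 := by
  refine ⟨fun l => rankOne ℂ (EuclideanSpace.single ⟨0, hm⟩ 1) (EuclideanSpace.single l 1), ?_⟩
  ext x k
  simp [EuclideanSpace.inner_single_left, Finset.sum_apply, Pi.single_apply]

/-- Compression `T ↦ W* T W` of operators by a fixed operator `W`. -/
noncomputable def compression (W : EuclideanSpace ℂ (Fin m) →L[ℂ] EuclideanSpace ℂ (Fin n)) :
    MatAlg n →ₗ[ℂ] MatAlg m where
  toFun T := adjoint W ∘L T ∘L W
  map_add' S T := by ext x : 1; simp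
  map_smul' c T := by ext x : 1; simp

lemma compression_apply (W : EuclideanSpace ℂ (Fin m) →L[ℂ] EuclideanSpace ℂ (Fin n))
    (T : MatAlg n) : compression W T = adjoint W ∘L T ∘L W := rfl

lemma isCP_compression (W : EuclideanSpace ℂ (Fin m) →L[ℂ] EuclideanSpace ℂ (Fin n)) :
    IsCP (compression W) := by
  rintro p M ⟨N, rfl⟩
  obtain rfl | hm := Nat.eq_zero_or_pos m
  · exact ⟨0, Subsingleton.elim _ _⟩
  obtain ⟨P, hP⟩ := exists_sum_adjoint_comp_eq_one n hm
  refine Matrix.exists_conjTranspose_mul_self_of_apply_eq_sum Finset.univ _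
    (fun (a : Fin p × Fin n) i => P a.2 ∘L N a.1 i ∘L W) fun i j => ?_
  rw [Fintype.sum_prod_type, Matrix.map_apply, Matrix.mul_apply, map_sum]
  refine Finset.sum_congr rfl fun k _ => ?_
  have h : star (N k i) * N k j = star (N k i) * (∑ l, adjoint (P l) ∘L P l) * N k j := by
    rw [hP, mul_one]
  rw [Matrix.conjTranspose_apply, h, Finset.mul_sum, Finset.sum_mul, map_sum]
  refine Finset.sum_congr rfl fun l _ => ?_
  simp only [compression_apply, star_eq_adjoint, adjoint_comp, mul_def, comp_assoc]

lemma norm_compression_le {W : EuclideanSpace ℂ (Fin m) →L[ℂ] EuclideanSpace ℂ (Fin n)}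
    (hW : ‖W‖ ≤ 1) (T : MatAlg n) : ‖compression W T‖ ≤ ‖T‖ := by
  have hW' : ‖adjoint W‖ ≤ 1 := by simpa using hW
  calc ‖compression W T‖ ≤ ‖adjoint W‖ * (‖T‖ * ‖W‖) :=
        (opNorm_comp_le _ _).trans (by gcongr; exact opNorm_comp_le _ _)
    _ ≤ 1 * (‖T‖ * 1) := by gcongr
    _ = ‖T‖ := by ring

end Compression

section DirectSum

lemma exists_coordinate_operators {ι : Type*} [Fintype ι] (n : ι → ℕ) :
    ∃ (N : ℕ) (Q : ∀ i, EuclideanSpace ℂ (Fin N) →L[ℂ] EuclideanSpace ℂ (Fin (n i))),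
      (∀ i, Q i ∘L adjoint (Q i) = 1) ∧ (∀ i j, i ≠ j → Q i ∘L adjoint (Q j) = 0) ∧
      ∀ x, ∑ i, ‖Q i x‖ ^ 2 = ‖x‖ ^ 2 := by
  classical
  let E := PiLp 2 fun i => EuclideanSpace ℂ (Fin (n i))
  let e : E ≃ₗᵢ[ℂ] EuclideanSpace ℂ (Fin (Module.finrank ℂ E)) := (stdOrthonormalBasis ℂ E).repr
  let π : ∀ i, E →L[ℂ] EuclideanSpace ℂ (Fin (n i)) := fun i => PiLp.proj 2 _ i
  let σ : ∀ j, EuclideanSpace ℂ (Fin (n j)) → E := fun j z => PiLp.single 2 j z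
  have hσ : ∀ j z, σ j z j = z := fun j z =>
    Pi.single_eq_same (M := fun j => EuclideanSpace ℂ (Fin (n j))) j z
  have hσ₀ : ∀ i j z, i ≠ j → σ j z i = 0 := fun i j z h =>
    Pi.single_eq_of_ne (M := fun j => EuclideanSpace ℂ (Fin (n j))) h z
  have hadj : ∀ j z, adjoint (π j ∘L e.symm.toContinuousLinearEquiv.toContinuousLinearMap) z =
      e (σ j z) := by
    intro j z
    refine ext_inner_right ℂ fun v => ?_
    rw [adjoint_inner_left, ← e.symm.inner_map_map (e _), e.symm_apply_apply,
      PiLp.inner_apply (σ j z), Finset.sum_eq_single j (fun i _ hi => by simp [hσ₀ i j z hi])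
      (by simp), hσ]
    rfl
  refine ⟨_, fun i => π i ∘L e.symm.toContinuousLinearEquiv.toContinuousLinearMap,
    fun i => ?_, fun i j hij => ?_, fun x => ?_⟩
  · ext z : 1
    rw [comp_apply, hadj]
    change π i (e.symm (e (σ i z))) = z
    rw [e.symm_apply_apply]
    exact hσ i z
  · ext z : 1
    rw [comp_apply, hadj]
    change π i (e.symm (e (σ j z))) = 0
    rw [e.symm_apply_apply]
    exact hσ₀ i j z hij
  · rw [← e.symm.norm_map, PiLp.norm_sq_eq_of_L2]
    rfl

lemma norm_sum_compression_le {ι : Type*} [Fintype ι] {n : ι → ℕ} {N : ℕ}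
    {Q : ∀ i, EuclideanSpace ℂ (Fin N) →L[ℂ] EuclideanSpace ℂ (Fin (n i))}
    (hQ : ∀ x, ∑ i, ‖Q i x‖ ^ 2 = ‖x‖ ^ 2) (T : ∀ i, MatAlg (n i)) {c : ℝ} (hc : 0 ≤ c)
    (hT : ∀ i, ‖T i‖ ≤ c) : ‖∑ i, compression (Q i) (T i)‖ ≤ c := by
  refine opNorm_le_of_re_inner_le hc fun x y hx hy => ?_
  calc RCLike.re ⟪(∑ i, compression (Q i) (T i)) x, y⟫_ℂ
      ≤ ‖⟪(∑ i, compression (Q i) (T i)) x, y⟫_ℂ‖ := RCLike.re_le_norm _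
    _ = ‖∑ i, ⟪T i (Q i x), Q i y⟫_ℂ‖ := by
      simp only [sum_apply, sum_inner, compression_apply, comp_apply, adjoint_inner_left]
    _ ≤ ∑ i, c * (‖Q i x‖ * ‖Q i y‖) := by
      refine (norm_sum_le _ _).trans (Finset.sum_le_sum fun i _ => ?_)
      calc _ ≤ ‖T i (Q i x)‖ * ‖Q i y‖ := norm_inner_le_norm _ _
        _ ≤ (c * ‖Q i x‖) * ‖Q i y‖ := by
          gcongr
          exact (T i).le_of_opNorm_le (hT i) _
        _ = _ := by ring
    _ ≤ c * (‖x‖ * ‖y‖) := by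
      rw [← Finset.mul_sum]
      gcongr
      refine (Real.sum_mul_le_sqrt_mul_sqrt _ _ _).trans_eq ?_
      rw [hQ, hQ, Real.sqrt_sq (norm_nonneg _), Real.sqrt_sq (norm_nonneg _)]
    _ = c := by rw [hx, hy, mul_one, mul_one]

end DirectSum

section Multiplication

variable {X B : Type*} [TopologicalSpace X] [NonUnitalCStarAlgebra B]

/-- The map `b ↦ f ⊗ b` for a compactly supported real function `f`. -/
noncomputable def tensorLM (f : C(X, ℝ)) (hf : HasCompactSupport f) : B →ₗ[ℂ] C₀(X, B) where
  toFun b :=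
    { toFun := fun y => (f y : ℂ) • b
      continuous_toFun := by fun_prop
      zero_at_infty' := by
        refine HasCompactSupport.is_zero_at_infty (hf.mono fun y hy => ?_)
        contrapose! hy
        simp_all }
  map_add' a b := by ext y; exact smul_add _ _ _
  map_smul' c b := by ext y; exact smul_comm _ _ _

lemma tensorLM_apply (f : C(X, ℝ)) (hf : HasCompactSupport f) (b : B) (y : X) :
    tensorLM f hf b y = (f y : ℂ) • b := rfl

lemma isCP_tensorLM (f : C(X, ℝ)) (hf : HasCompactSupport f) (hf₀ : ∀ y, 0 ≤ f y) :
    IsCP (tensorLM (B := B) f hf) := by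
  rintro n M ⟨N, rfl⟩
  let g : C(X, ℝ) := ⟨fun y => √(f y), by fun_prop⟩
  have hg : HasCompactSupport g := hf.comp_left Real.sqrt_zero
  have hgg : ∀ y, (g y : ℂ) * g y = f y := fun y => by
    exact_mod_cast Real.mul_self_sqrt (hf₀ y)
  refine ⟨N.map (tensorLM g hg), ?_⟩
  ext i j y
  simp only [Matrix.map_apply, Matrix.mul_apply, map_sum, Matrix.conjTranspose_apply]
  change evalLM y _ = evalLM y _
  rw [map_sum, map_sum]
  refine Finset.sum_congr rfl fun k _ => ?_
  change (f y : ℂ) • (star (N k i) * N k j) = star ((g y : ℂ) • N k i) * ((g y : ℂ) • N k j)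
  rw [star_smul, smul_mul_smul_comm, ← hgg]
  simp

lemma ZeroAtInftyContinuousMap.norm_le_of_forall {f : C₀(X, B)} {c : ℝ} (hc : 0 ≤ c)
    (h : ∀ y, ‖f y‖ ≤ c) : ‖f‖ ≤ c :=
  (BoundedContinuousFunction.norm_le hc).mpr h

lemma ZeroAtInftyContinuousMap.norm_apply_le (f : C₀(X, B)) (y : X) : ‖f y‖ ≤ ‖f‖ :=
  f.toBCF.norm_coe_le_norm y

end Multiplication

section PartitionOfUnity

variable {X : Type*} [TopologicalSpace X] [LocallyCompactSpace X] [T2Space X]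

lemma IsCompact.exists_partition_of_nhds {K : Set X} (hK : IsCompact K) (U : X → Set X)
    (hU : ∀ x, U x ∈ nhds x) :
    ∃ (t : Finset X) (f : t → C(X, ℝ)), (∀ i, HasCompactSupport (f i)) ∧ (∀ i y, 0 ≤ f i y) ∧
      (∀ y, ∑ i, f i y ≤ 1) ∧ (∀ y ∈ K, ∑ i, f i y = 1) ∧ ∀ i y, f i y ≠ 0 → y ∈ U i := by
  obtain ⟨t, -, ht⟩ := hK.elim_nhds_subcover (fun x => interior (U x))
    fun x _ => interior_mem_nhds.mpr (hU x)
  obtain ⟨f, hf, hfc⟩ := PartitionOfUnity.exists_isSubordinate_of_locallyFinite_t2space hK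
    (fun i : t => interior (U i)) (fun _ => isOpen_interior) (locallyFinite_of_finite _)
    (by simpa [Set.iUnion_subtype] using ht)
  refine ⟨t, f, hfc, f.nonneg, fun y => ?_, fun y hy => ?_, fun i y hy => ?_⟩
  · simpa [finsum_eq_sum_of_fintype] using f.sum_le_one y
  · simpa [finsum_eq_sum_of_fintype] using f.sum_eq_one hy
  · exact interior_subset (hf i (subset_tsupport _ hy))

end PartitionOfUnity

section Gluing

variable {X A B : Type*} [TopologicalSpace X] [NonUnitalCStarAlgebra A] [NonUnitalCStarAlgebra B]

/-- Finitely many factorizations through matrix algebras assemble, via a subordinate family of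
functions, into one factorization through the block-diagonal matrices. -/
lemma exists_glued_factorization {ι : Type*} [Fintype ι] (f : ι → C(X, ℝ))
    (hfc : ∀ i, HasCompactSupport (f i)) (hf₀ : ∀ i y, 0 ≤ f i y) (hf₁ : ∀ y, ∑ i, f i y ≤ 1)
    {n : ι → ℕ} (κ : ∀ i, A →ₗ[ℂ] MatAlg (n i)) (ρ : ∀ i, MatAlg (n i) →ₗ[ℂ] B)
    (hκ : ∀ i, IsCP (κ i)) (hρ : ∀ i, IsCP (ρ i)) (hκ₁ : ∀ i a, ‖κ i a‖ ≤ ‖a‖)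
    (hρ₁ : ∀ i m, ‖ρ i m‖ ≤ ‖m‖) :
    ∃ (N : ℕ) (κ' : A →ₗ[ℂ] MatAlg N) (ρ' : MatAlg N →ₗ[ℂ] C₀(X, B)),
      IsCP κ' ∧ IsCP ρ' ∧ (∀ a, ‖κ' a‖ ≤ ‖a‖) ∧ (∀ m, ‖ρ' m‖ ≤ ‖m‖) ∧
        ∀ a y, ρ' (κ' a) y = ∑ i, (f i y : ℂ) • ρ i (κ i a) := by
  obtain ⟨N, Q, hQ₁, hQ₀, hQ⟩ := exists_coordinate_operators n
  have hQn : ∀ i, ‖adjoint (Q i)‖ ≤ 1 := fun i => by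
    rw [LinearIsometryEquiv.norm_map]
    refine opNorm_le_bound _ zero_le_one fun x => ?_
    rw [one_mul, ← sq_le_sq₀ (norm_nonneg _) (norm_nonneg _), ← hQ x]
    exact Finset.single_le_sum (f := fun i => ‖Q i x‖ ^ 2) (fun _ _ => sq_nonneg _)
      (Finset.mem_univ i)
  have hκ'_apply : ∀ a, (∑ i, (compression (Q i)).comp (κ i)) a =
      ∑ i, compression (Q i) (κ i a) := fun a => by simp
  have hρ'_apply : ∀ m y, (∑ i, ((tensorLM (f i) (hfc i)).comp (ρ i)).comp
      (compression (adjoint (Q i)))) m y =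
      ∑ i, (f i y : ℂ) • ρ i (compression (adjoint (Q i)) m) := fun m y => by
    change evalLM y _ = _
    rw [LinearMap.sum_apply, map_sum]
    rfl
  refine ⟨N, ∑ i, (compression (Q i)).comp (κ i),
    ∑ i, ((tensorLM (f i) (hfc i)).comp (ρ i)).comp (compression (adjoint (Q i))),
    IsCP.sum _ fun i _ => (isCP_compression _).comp (hκ i),
    IsCP.sum _ fun i _ => ((isCP_tensorLM _ _ (hf₀ i)).comp (hρ i)).comp (isCP_compression _),
    fun a => ?_, fun m => ?_, fun a y => ?_⟩
  · rw [hκ'_apply]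
    exact norm_sum_compression_le hQ _ (norm_nonneg a) fun i => hκ₁ i a
  · refine ZeroAtInftyContinuousMap.norm_le_of_forall (norm_nonneg m) fun y => ?_
    rw [hρ'_apply]
    calc _ ≤ ∑ i, f i y * ‖m‖ := by
          refine (norm_sum_le _ _).trans (Finset.sum_le_sum fun i _ => ?_)
          rw [norm_smul, Complex.norm_of_nonneg (hf₀ i y)]
          exact mul_le_mul_of_nonneg_left
            ((hρ₁ i _).trans (norm_compression_le (hQn i) m)) (hf₀ i y)
      _ ≤ 1 * ‖m‖ := by
          rw [← Finset.sum_mul]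
          gcongr
          exact hf₁ y
      _ = ‖m‖ := one_mul _
  · rw [hρ'_apply, hκ'_apply]
    refine Finset.sum_congr rfl fun i _ => ?_
    congr 2
    rw [map_sum, Finset.sum_eq_single i]
    · ext x : 1
      have h : ∀ z, Q i (adjoint (Q i) z) = z := fun z => DFunLike.congr_fun (hQ₁ i) z
      simp [compression_apply, h]
    · intro j _ hj
      ext x : 1
      have h : ∀ z, Q i (adjoint (Q j) z) = 0 := fun z => DFunLike.congr_fun (hQ₀ i j hj.symm) z
      simp [compression_apply, h]
    · simp

/-- A convex combination, with total weight at most one, of elements close to `v` is close to `v`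
if `v` is small or the total weight is one. -/
lemma norm_sub_sum_smul_le {ι : Type*} [Fintype ι] {v : B} {w : ι → B} {c : ι → ℝ} {δ : ℝ}
    (hc₀ : ∀ i, 0 ≤ c i) (hc₁ : ∑ i, c i ≤ 1) (hv : ‖v‖ ≤ δ ∨ ∑ i, c i = 1)
    (hw : ∀ i, c i ≠ 0 → ‖v - w i‖ ≤ δ) : ‖v - ∑ i, (c i : ℂ) • w i‖ ≤ δ := by
  have key : v - ∑ i, (c i : ℂ) • w i =
      ((1 - ∑ i, c i : ℝ) : ℂ) • v + ∑ i, (c i : ℂ) • (v - w i) := by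
    simp only [smul_sub, Finset.sum_sub_distrib, ← Finset.sum_smul]
    push_cast
    module
  have h1 : ‖((1 - ∑ i, c i : ℝ) : ℂ) • v‖ ≤ (1 - ∑ i, c i) * δ := by
    rw [norm_smul, Complex.norm_of_nonneg (by linarith)]
    obtain h | h := hv
    · exact mul_le_mul_of_nonneg_left h (by linarith)
    · simp [h]
  have h2 : ‖∑ i, (c i : ℂ) • (v - w i)‖ ≤ ∑ i, c i * δ := by
    refine (norm_sum_le _ _).trans (Finset.sum_le_sum fun i _ => ?_)
    rw [norm_smul, Complex.norm_of_nonneg (hc₀ i)]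
    obtain h | h := eq_or_ne (c i) 0
    · simp [h]
    · exact mul_le_mul_of_nonneg_left (hw i h) (hc₀ i)
  rw [key]
  refine (norm_add_le _ _).trans ((add_le_add h1 h2).trans_eq ?_)
  rw [← Finset.sum_mul]
  ring

end Gluing

/-- A completely positive map `φ : A → C₀(X, B)` is nuclear iff `ev_x ∘ φ` is nuclear for
every `x ∈ X`. -/
theorem nuclear_iff_eval_nuclear {X : Type*} [TopologicalSpace X] [LocallyCompactSpace X]
    [T2Space X] {A B : Type*} [NonUnitalCStarAlgebra A] [NonUnitalCStarAlgebra B]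
    (φ : A →ₗ[ℂ] C₀(X, B)) (hφ : IsCP φ) :
    IsNuclearMap φ ↔ ∀ x : X, IsNuclearMap ((evalLM x).comp φ) := by
  refine ⟨fun h x ε hε F => ?_, fun h ε hε F => ?_⟩
  · obtain ⟨n, κ, ρ, hκ, hρ, hκ₁, hρ₁, hF⟩ := h ε hε F
    exact ⟨n, κ, (evalLM x).comp ρ, hκ, (isCP_evalLM x).comp hρ, hκ₁,
      fun m => ((ρ m).norm_apply_le x).trans (hρ₁ m),
      fun a ha => ((φ a - ρ (κ a)).norm_apply_le x).trans (hF a ha)⟩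
  · choose n κ ρ hκ hρ hκ₁ hρ₁ hF using fun x => h x (ε / 2) (half_pos hε) F
    have hU : ∀ x, {y | ∀ a ∈ F, ‖φ a y - ρ x (κ x a)‖ ≤ ε} ∈ nhds x := fun x => by
      refine (Filter.eventually_all_finset F).mpr fun a ha => ?_
      have hcont : Continuous fun y => ‖φ a y - ρ x (κ x a)‖ := by fun_prop
      filter_upwards [hcont.continuousAt.eventually_lt continuousAt_const
        ((hF x a ha).trans_lt (half_lt_self hε))] with y hy using le_of_lt hy
    have hsmall : ∀ᶠ y in Filter.cocompact X, ∀ a ∈ F, ‖φ a y‖ ≤ ε := by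
      refine (Filter.eventually_all_finset F).mpr fun a _ => ?_
      have h0 := (φ a).zero_at_infty'.norm
      rw [norm_zero] at h0
      exact (h0.eventually_lt_const hε).mono fun y hy => le_of_lt hy
    obtain ⟨K, hK, hKs⟩ := Filter.mem_cocompact.mp hsmall
    obtain ⟨t, f, hfc, hf₀, hf₁, hfK, hfU⟩ := hK.exists_partition_of_nhds _ hU
    obtain ⟨N, κ', ρ', hκ', hρ', hκ'₁, hρ'₁, happly⟩ :=
      exists_glued_factorization f hfc hf₀ hf₁ (fun i => κ i) (fun i => ρ i) (fun i => hκ i)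
        (fun i => hρ i) (fun i => hκ₁ i) fun i => hρ₁ i
    refine ⟨N, κ', ρ', hκ', hρ', hκ'₁, hρ'₁, fun a ha => ?_⟩
    refine ZeroAtInftyContinuousMap.norm_le_of_forall hε.le fun y => ?_
    change ‖φ a y - ρ' (κ' a) y‖ ≤ ε
    rw [happly]
    refine norm_sub_sum_smul_le (hf₀ · y) (hf₁ y) ?_ fun i hi => hfU i y hi a ha
    by_cases hy : y ∈ K
    · exact .inr (hfK y hy)
    · exact .inl (hKs hy a ha)
end
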